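/- Under the hypotheses of the switching subgradient method with K ≥ 4C/(μ ε̂²): let X ⊆ ℝ^d be a nonempty convex set, μ > 0, C > 0, ε̂ > 0, F, G : ℝ^d → ℝ, F', G' : ℝ^d → ℝ^d satisfying for all z, y ∈ X the inequalities F(y) ≥ F(z) + ⟪F'(z), y − z⟫ + (μ/2)‖y − z‖², G(y) ≥ G(z) + ⟪G'(z), y − z⟫ + (μ/2)‖y − z‖², ‖F'(z)‖² ≤ 2C, ‖G'(z)‖² ≤ 2C; x̂ ∈ X with G(x̂) ≤ 0; z_0, …, z_K ∈ X with, for each k < K and γ_k = 2/(μ(k+2)): if G(z_k) ≤ ε̂² then ⟪(z_k − γ_k F'(z_k)) − z_{k+1}, y − z_{k+1}⟫ ≤ 0 for all y ∈ X, else ⟪(z_k − γ_k G'(z_k)) − z_{k+1}, y − z_{k+1}⟫ ≤ 0 for all y ∈ X; and additionally F(z_k) ≥ F(x̂) for... rather, suppose F(x̂) ≤ F(y) for every y ∈ X with G(y) ≤ 0 and K is a positive integer with K ≥ 4C/(μ ε̂²). Then there exists k < K with G(z_k) ≤ ε̂² (i.e., the index set I of objective steps is nonempty). -/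

import Mathlib

open scoped RealInnerProductSpace BigOperators

/-- A point characterized by the variational inequality of the projection is at least as close
to `y` as the projected point. -/
lemma norm_sub_sq_le_of_inner_sub_nonpos {E : Type*} [NormedAddCommGroup E]
    [InnerProductSpace ℝ E] {w p y : E} (h : ⟪w - p, y - p⟫ ≤ 0) :
    ‖p - y‖ ^ 2 ≤ ‖w - y‖ ^ 2 := by
  have h_eq : w - y = (w - p) - (y - p) := by abel
  rw [h_eq, norm_sub_rev p y, norm_sub_sq_real (w - p)]
  nlinarith [sq_nonneg ‖w - p‖]

/-- Progress of one projected subgradient step of length `γ` along `g` for a `μ`-strongly convex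
function whose value at `z` exceeds its value at `x` by at least `e`. -/
lemma norm_sub_sq_le_of_projected_subgradient_step {E : Type*} [NormedAddCommGroup E]
    [InnerProductSpace ℝ E] {z p x g : E} {γ μ C e : ℝ} (hγ : 0 ≤ γ)
    (hproj : ⟪(z - γ • g) - p, x - p⟫ ≤ 0) (hg : ‖g‖ ^ 2 ≤ 2 * C)
    (hgap : e + ⟪g, x - z⟫ + μ / 2 * ‖x - z‖ ^ 2 ≤ 0) :
    ‖p - x‖ ^ 2 ≤ (1 - γ * μ) * ‖z - x‖ ^ 2 - 2 * γ * e + γ ^ 2 * (2 * C) := by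
  have h_eq : z - γ • g - x = -((x - z) + γ • g) := by abel
  have h_proj := norm_sub_sq_le_of_inner_sub_nonpos hproj
  rw [h_eq, norm_neg, norm_add_sq_real, real_inner_smul_right, norm_smul, mul_pow,
    Real.norm_eq_abs, sq_abs, real_inner_comm] at h_proj
  rw [norm_sub_rev z x]
  nlinarith [mul_le_mul_of_nonneg_left hg (sq_nonneg γ), mul_le_mul_of_nonneg_left hgap hγ]

/-- The telescoped form of the strongly convex subgradient recursion with step lengths
`2 / (μ (k + 2))`. -/
lemma mul_le_of_subgradient_recursion {D : ℕ → ℝ} {μ C e : ℝ} {K : ℕ} (hμ : 0 < μ) (hC : 0 ≤ C)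
    (hD : ∀ k < K, D (k + 1) ≤ (1 - 2 / (μ * ((k : ℝ) + 2)) * μ) * D k
      - 2 * (2 / (μ * ((k : ℝ) + 2))) * e + (2 / (μ * ((k : ℝ) + 2))) ^ 2 * (2 * C)) :
    (K : ℝ) * (K + 1) * D K ≤ 8 * C / μ ^ 2 * K - 2 * e / μ * (K * (K + 1)) := by
  induction K with
  | zero => simp
  | succ k ih =>
    have h_prev := ih fun j hj => hD j (by omega)
    have h_mul := mul_le_mul_of_nonneg_left (hD k (by omega))
      (by positivity : (0 : ℝ) ≤ ((k : ℝ) + 1) * (k + 2))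
    have h_eq : ((k : ℝ) + 1) * (k + 2) * ((1 - 2 / (μ * ((k : ℝ) + 2)) * μ) * D k
        - 2 * (2 / (μ * ((k : ℝ) + 2))) * e + (2 / (μ * ((k : ℝ) + 2))) ^ 2 * (2 * C))
        = k * (k + 1) * D k - 4 * e / μ * (k + 1)
          + 8 * C / μ ^ 2 * (((k : ℝ) + 1) / (k + 2)) := by
      field_simp
      ring
    have h_ratio : ((k : ℝ) + 1) / (k + 2) ≤ 1 := by
      rw [div_le_one (by positivity)]
      linarith
    have h_const := mul_le_mul_of_nonneg_left h_ratio (by positivity : 0 ≤ 8 * C / μ ^ 2)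
    rw [h_eq] at h_mul
    push_cast
    linear_combination h_mul + h_prev + h_const

/-- Implicit claim in the proof of Theorem 2: the set of objective-step indices of the
switching subgradient method is nonempty when K ≥ 4C/(μ ε̂²). -/
theorem switching_subgradient_objective_step_exists {d : ℕ}
    (X : Set (EuclideanSpace ℝ (Fin d)))
    (hX : Convex ℝ X) (hXne : X.Nonempty) (μ C εhat : ℝ)
    (hμ : 0 < μ) (hC : 0 < C) (hεhat : 0 < εhat)
    (F G : EuclideanSpace ℝ (Fin d) → ℝ)
    (F' G' : EuclideanSpace ℝ (Fin d) → EuclideanSpace ℝ (Fin d))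
    (hFsub : ∀ z ∈ X, ∀ y ∈ X, F y ≥ F z + ⟪F' z, y - z⟫ + μ / 2 * ‖y - z‖ ^ 2)
    (hGsub : ∀ z ∈ X, ∀ y ∈ X, G y ≥ G z + ⟪G' z, y - z⟫ + μ / 2 * ‖y - z‖ ^ 2)
    (hFbound : ∀ z ∈ X, ‖F' z‖ ^ 2 ≤ 2 * C)
    (hGbound : ∀ z ∈ X, ‖G' z‖ ^ 2 ≤ 2 * C)
    (xhat : EuclideanSpace ℝ (Fin d)) (hxhatX : xhat ∈ X) (hxhatfeas : G xhat ≤ 0)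
    (hxhatopt : ∀ y ∈ X, G y ≤ 0 → F xhat ≤ F y)
    (K : ℕ) (hK : 1 ≤ K) (hKbig : (K : ℝ) ≥ 4 * C / (μ * εhat ^ 2))
    (z : ℕ → EuclideanSpace ℝ (Fin d)) (hzX : ∀ k ≤ K, z k ∈ X)
    (hstep : ∀ k < K,
      (G (z k) ≤ εhat ^ 2 →
        ∀ y ∈ X, ⟪(z k - (2 / (μ * ((k : ℝ) + 2))) • F' (z k)) - z (k + 1), y - z (k + 1)⟫ ≤ 0) ∧
      (¬ G (z k) ≤ εhat ^ 2 →
        ∀ y ∈ X, ⟪(z k - (2 / (μ * ((k : ℝ) + 2))) • G' (z k)) - z (k + 1), y - z (k + 1)⟫ ≤ 0)) :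
    ∃ k < K, G (z k) ≤ εhat ^ 2 := by
  by_contra! h_none
  have h_rec := mul_le_of_subgradient_recursion (D := fun k => ‖z k - xhat‖ ^ 2)
    (e := εhat ^ 2) hμ hC.le fun k hk =>
      norm_sub_sq_le_of_projected_subgradient_step (by positivity)
        ((hstep k hk).2 (h_none k hk).not_ge xhat hxhatX) (hGbound _ (hzX k hk.le))
        (by linarith [hGsub _ (hzX k hk.le) xhat hxhatX, h_none k hk])
  have h_K : (0 : ℝ) < K := by exact_mod_cast hK
  have h_nonneg : (0 : ℝ) ≤ (K : ℝ) * (K + 1) * ‖z K - xhat‖ ^ 2 := by positivity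
  have h_big : 4 * C ≤ K * (μ * εhat ^ 2) := (div_le_iff₀ (by positivity)).1 hKbig
  have h_eq : 8 * C / μ ^ 2 * K - 2 * εhat ^ 2 / μ * (K * (K + 1))
      = 2 * K / μ ^ 2 * (4 * C - (K + 1) * (μ * εhat ^ 2)) := by
    field_simp
    ring
  have h_neg : 2 * K / μ ^ 2 * (4 * C - (K + 1) * (μ * εhat ^ 2)) < 0 :=
    mul_neg_of_pos_of_neg (by positivity) (by nlinarith [mul_pos hμ (pow_pos hεhat 2)])
  linarith
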